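/- Let ω > 0, m ∈ (1,2), α = β = 0. Let v⁻ satisfy m/2 < v⁻ < 1 and let v⁺ > v̄⁺, where v̄⁺ > 1 is the unique root of the secant equation B(v̄⁺) - B(v⁻) = B′(v⁻)(v̄⁺ - v⁻). Define c := (B(v⁺) - B(v⁻))/(v⁺ - v⁻) < 0 and K₀ := B(v⁻) - c v⁻. Then there exists a continuously differentiable, strictly increasing function v : ℝ → (0,∞) with v⁻ < v(ξ) < v⁺ for all ξ, lim_{ξ→-∞} v(ξ) = v⁻, lim_{ξ→+∞} v(ξ) = v⁺, and d/dξ [A(v(ξ))] = K₀ + c v(ξ) - B(v(ξ)) for all ξ ∈ ℝ. Consequently φ(x,t) := v(x + c(T-t)) is a traveling wave solution, with negative wave speed c and increasing profile, of the equation ∂ₜφ + ∂ₓₓ A(φ) + ∂ₓ B(φ) = 0. -/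

import Mathlib

/-- The function `A` of the general model with `α = β = 0`:
`A(φ) = (1/m)φ` for `0 < φ ≤ 1`, `A(φ) = 1 - ((m-1)/m)φ^{-1/(m-1)}` for `φ > 1`. -/
noncomputable def A0 (m φ : ℝ) : ℝ :=
  if φ ≤ 1 then 1 / m * φ else 1 - (m - 1) / m * φ ^ (-(1 / (m - 1)))

/-- The function `B` of the general model with `α = β = 0`. -/
noncomputable def B0 (m ω v : ℝ) : ℝ :=
  if v ≤ 1 then ω * v - ω / m * v ^ 2 - ω * (m - 1) / m
  else (m - 1) / m * ω * (v ^ ((m - 2) / (m - 1)) - 1)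

open Set Filter Topology

section Profile

variable {a b L x₀ : ℝ} {F Φ : ℝ → ℝ}

/-- An antiderivative of `1 / F` is unbounded above at a right endpoint where `F` vanishes
at most linearly. -/
lemma exists_gt_of_hasDerivAt_inv (hx₀ : x₀ ∈ Ioo a b) (hL : 0 < L)
    (hpos : ∀ x ∈ Ioo a b, 0 < F x) (hFb : ∀ x ∈ Ioo a b, F x ≤ L * (b - x))
    (hΦ : ∀ x ∈ Ioo a b, HasDerivAt Φ (F x)⁻¹ x) (ξ : ℝ) :
    ∃ y ∈ Ioo a b, ξ < Φ y := by
  have hmono : MonotoneOn (fun y => Φ y + L⁻¹ * Real.log (b - y)) (Ioo a b) := by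
    have hd : ∀ x ∈ Ioo a b, HasDerivAt (fun y => Φ y + L⁻¹ * Real.log (b - y))
        ((F x)⁻¹ + L⁻¹ * (-1 / (b - x))) x := fun x hx =>
      (hΦ x hx).add ((((hasDerivAt_id x).const_sub b).log (sub_pos.2 hx.2).ne').const_mul _)
    refine monotoneOn_of_hasDerivWithinAt_nonneg (convex_Ioo a b)
      (fun x hx => (hd x hx).continuousAt.continuousWithinAt)
      (fun x hx => (hd x (interior_subset hx)).hasDerivWithinAt) fun x hx => ?_
    have hx := interior_subset hx
    have h := inv_anti₀ (hpos x hx) (hFb x hx)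
    rw [mul_inv] at h
    rw [neg_div, one_div]
    linarith
  have hlog : Tendsto (fun y => Real.log (b - y)) (𝓝[<] b) atBot := by
    refine Real.tendsto_log_nhdsGT_zero.comp (tendsto_nhdsWithin_iff.2 ⟨?_, ?_⟩)
    · have : Tendsto (fun y => b - y) (𝓝 b) (𝓝 (b - b)) :=
        tendsto_const_nhds.sub tendsto_id
      rw [sub_self] at this
      exact this.mono_left nhdsWithin_le_nhds
    · filter_upwards [self_mem_nhdsWithin] with y hy using sub_pos.2 (mem_Iio.1 hy)
  obtain ⟨y, hlogy, hy⟩ := ((hlog.eventually_lt_atBot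
    (L * (Φ x₀ + L⁻¹ * Real.log (b - x₀) - ξ))).and (Ioo_mem_nhdsLT hx₀.2)).exists
  have hyab : y ∈ Ioo a b := ⟨hx₀.1.trans hy.1, hy.2⟩
  refine ⟨y, hyab, ?_⟩
  have h := hmono hx₀ hyab hy.1.le
  have h' := mul_lt_mul_of_pos_left hlogy (inv_pos.2 hL)
  rw [inv_mul_cancel_left₀ hL.ne'] at h'
  dsimp only at h
  linarith

/-- An antiderivative of `1 / F` is unbounded below at a left endpoint where `F` vanishes
at most linearly. -/
lemma exists_lt_of_hasDerivAt_inv (hx₀ : x₀ ∈ Ioo a b) (hL : 0 < L)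
    (hpos : ∀ x ∈ Ioo a b, 0 < F x) (hFa : ∀ x ∈ Ioo a b, F x ≤ L * (x - a))
    (hΦ : ∀ x ∈ Ioo a b, HasDerivAt Φ (F x)⁻¹ x) (ξ : ℝ) :
    ∃ y ∈ Ioo a b, Φ y < ξ := by
  have hneg : ∀ x ∈ Ioo (-b) (-a), -x ∈ Ioo a b := fun x hx =>
    ⟨lt_neg.1 hx.2, neg_lt.1 hx.1⟩
  obtain ⟨y, hy, hξ⟩ := exists_gt_of_hasDerivAt_inv (a := -b) (b := -a) (x₀ := -x₀)
    (F := fun x => F (-x)) (Φ := fun x => -Φ (-x))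
    ⟨neg_lt_neg hx₀.2, neg_lt_neg hx₀.1⟩ hL (fun x hx => hpos _ (hneg x hx))
    (fun x hx => (hFa _ (hneg x hx)).trans_eq (by ring))
    (fun x hx => HasDerivAt.congr_deriv (f' := -((F (-x))⁻¹ * -1))
      ((hΦ _ (hneg x hx)).comp x (hasDerivAt_neg x)).neg (by ring)) (-ξ)
  exact ⟨-y, hneg y hy, neg_lt_neg_iff.1 hξ⟩

/-- The autonomous equation `v' = F(v)`, with `F` positive on `(a, b)` and vanishing at most
linearly at both ends, has a global increasing solution connecting `a` to `b`. -/
lemma exists_strictMono_profile (hab : a < b) (hL : 0 < L) (hF : ContinuousOn F (Ioo a b))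
    (hpos : ∀ x ∈ Ioo a b, 0 < F x) (hFa : ∀ x ∈ Ioo a b, F x ≤ L * (x - a))
    (hFb : ∀ x ∈ Ioo a b, F x ≤ L * (b - x)) :
    ∃ v : ℝ → ℝ, StrictMono v ∧ (∀ ξ, v ξ ∈ Ioo a b) ∧ (∀ ξ, HasDerivAt v (F (v ξ)) ξ) ∧
      Tendsto v atBot (𝓝 a) ∧ Tendsto v atTop (𝓝 b) := by
  obtain ⟨x₀, hx₀⟩ := nonempty_Ioo.2 hab
  have hinv : ContinuousOn (fun x => (F x)⁻¹) (Ioo a b) := hF.inv₀ fun x hx => (hpos x hx).ne'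
  obtain ⟨Φ, hΦ⟩ : ∃ Φ : ℝ → ℝ, ∀ x ∈ Ioo a b, HasDerivAt Φ (F x)⁻¹ x := by
    refine ⟨fun y => ∫ x in x₀..y, (F x)⁻¹, fun x hx => ?_⟩
    exact intervalIntegral.integral_hasDerivAt_right
      (hinv.mono (ordConnected_Ioo.uIcc_subset hx₀ hx)).intervalIntegrable
      (hinv.stronglyMeasurableAtFilter isOpen_Ioo x hx)
      (hinv.continuousAt (isOpen_Ioo.mem_nhds hx))
  have hΦc : ContinuousOn Φ (Ioo a b) := fun x hx => (hΦ x hx).continuousAt.continuousWithinAt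
  have hΦm : StrictMonoOn Φ (Ioo a b) :=
    strictMonoOn_of_hasDerivWithinAt_pos (convex_Ioo a b) hΦc
      (fun x hx => (hΦ x (interior_subset hx)).hasDerivWithinAt)
      fun x hx => inv_pos.2 (hpos x (interior_subset hx))
  have hsurj : ∀ ξ, ∃ y ∈ Ioo a b, Φ y = ξ := fun ξ => by
    obtain ⟨y₁, hy₁, h₁⟩ := exists_lt_of_hasDerivAt_inv hx₀ hL hpos hFa hΦ ξ
    obtain ⟨y₂, hy₂, h₂⟩ := exists_gt_of_hasDerivAt_inv hx₀ hL hpos hFb hΦ ξ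
    exact isPreconnected_Ioo.intermediate_value hy₁ hy₂ hΦc ⟨h₁.le, h₂.le⟩
  choose v hv hΦv using hsurj
  have hmono : StrictMono v := fun ξ η h => by
    rwa [← hΦm.lt_iff_lt (hv ξ) (hv η), hΦv, hΦv]
  have hrange : range v = Ioo a b := by
    refine Subset.antisymm (range_subset_iff.2 hv) fun y hy => ⟨Φ y, ?_⟩
    exact hΦm.injOn (hv _) hy (hΦv _)
  have hcont : ∀ ξ, ContinuousAt v ξ := fun ξ =>
    (hmono.strictMonoOn univ).continuousAt_of_image_mem_nhds univ_mem
      (by rw [image_univ, hrange]; exact isOpen_Ioo.mem_nhds (hv ξ))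
  refine ⟨v, hmono, hv, fun ξ => ?_, ?_, ?_⟩
  · simpa using HasDerivAt.of_local_left_inverse (hcont ξ) (hΦ _ (hv ξ))
      (inv_ne_zero (hpos _ (hv ξ)).ne') (Eventually.of_forall hΦv)
  · exact tendsto_atBot_isGLB hmono.monotone (hrange ▸ isGLB_Ioo hab)
  · exact tendsto_atTop_isLUB hmono.monotone (hrange ▸ isLUB_Ioo hab)

end Profile

lemma HasDerivAt.ite_le {f g : ℝ → ℝ} {p d : ℝ} (hf : HasDerivAt f d p)
    (hg : HasDerivAt g d p) (h : f p = g p) :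
    HasDerivAt (fun x => if x ≤ p then f x else g x) d p := by
  rw [← hasDerivWithinAt_univ, ← Iic_union_Ici (a := p)]
  refine HasDerivWithinAt.union
    (hf.hasDerivWithinAt.congr_of_mem (fun x hx => if_pos hx) self_mem_Iic)
    (hg.hasDerivWithinAt.congr_of_mem (fun x hx => ?_) self_mem_Ici)
  rcases (mem_Ici.1 hx).eq_or_lt with rfl | hx
  · simp [h]
  · exact if_neg hx.not_ge

lemma hasDerivAt_ite_le {f g f' g' : ℝ → ℝ} {p x : ℝ} (hf : x ≤ p → HasDerivAt f (f' x) x)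
    (hg : p ≤ x → HasDerivAt g (g' x) x) (h : f p = g p) (h' : f' p = g' p) :
    HasDerivAt (fun x => if x ≤ p then f x else g x) (if x ≤ p then f' x else g' x) x := by
  rcases lt_trichotomy x p with hx | rfl | hx
  · rw [if_pos hx.le]
    refine (hf hx.le).congr_of_eventuallyEq ?_
    filter_upwards [Iio_mem_nhds hx] with y hy using if_pos (le_of_lt hy)
  · rw [if_pos le_rfl]
    exact (hf le_rfl).ite_le (h' ▸ hg le_rfl) h
  · rw [if_neg hx.not_ge]
    refine (hg hx.le).congr_of_eventuallyEq ?_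
    filter_upwards [Ioi_mem_nhds hx] with y hy using if_neg (not_le_of_gt hy)

lemma convexOn_rpow_of_neg {p : ℝ} (hp : p < 0) : ConvexOn ℝ (Ioi 0) fun x : ℝ => x ^ p := by
  have hd : ∀ x ∈ Ioi (0 : ℝ), HasDerivAt (fun x : ℝ => x ^ p) (p * x ^ (p - 1)) x :=
    fun x hx => Real.hasDerivAt_rpow_const (Or.inl (ne_of_gt hx))
  refine MonotoneOn.convexOn_of_deriv (convex_Ioi 0)
    (fun x hx => (hd x hx).continuousAt.continuousWithinAt) ?_ ?_ <;> rw [interior_Ioi]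
  · exact fun x hx => (hd x hx).differentiableAt.differentiableWithinAt
  · intro x hx y hy hxy
    rw [(hd x hx).deriv, (hd y hy).deriv]
    exact mul_le_mul_of_nonpos_left
      (Real.rpow_le_rpow_of_nonpos hx hxy (by linarith)) hp.le

section Coefficients

variable {m ω : ℝ}

lemma A0_hasDerivAt (hm : 1 < m) {x : ℝ} (hx : 0 < x) :
    HasDerivAt (A0 m) (1 / m * max x 1 ^ (-(1 / (m - 1)) - 1)) x := by
  have hm0 : m ≠ 0 := by positivity
  have hm1 : m - 1 ≠ 0 := by linarith
  have h := hasDerivAt_ite_le (p := 1) (x := x) (f := fun φ => 1 / m * φ)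
    (g := fun φ => 1 - (m - 1) / m * φ ^ (-(1 / (m - 1))))
    (f' := fun _ => 1 / m) (g' := fun φ => 1 / m * φ ^ (-(1 / (m - 1)) - 1))
    (fun _ => by simpa using (hasDerivAt_id x).const_mul (1 / m))
    (fun _ => (((Real.hasDerivAt_rpow_const (p := -(1 / (m - 1)))
      (Or.inl hx.ne')).const_mul ((m - 1) / m)).const_sub 1).congr_deriv (by field_simp))
    (by simp; field_simp; ring) (by simp)
  refine HasDerivAt.congr_deriv (f := A0 m) h ?_
  split_ifs with h1
  · simp [max_eq_right h1]
  · rw [max_eq_left (not_le.1 h1).le]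

lemma B0_hasDerivAt (hm : 1 < m) {x : ℝ} (hx : 0 < x) :
    HasDerivAt (B0 m ω) (if x ≤ 1 then ω - 2 * ω / m * x
      else ω * (m - 2) / m * x ^ ((m - 2) / (m - 1) - 1)) x := by
  have hm0 : m ≠ 0 := by positivity
  have hm1 : m - 1 ≠ 0 := by linarith
  refine hasDerivAt_ite_le (p := 1) (x := x)
    (f := fun v => ω * v - ω / m * v ^ 2 - ω * (m - 1) / m)
    (g := fun v => (m - 1) / m * ω * (v ^ ((m - 2) / (m - 1)) - 1))
    (f' := fun v => ω - 2 * ω / m * v)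
    (g' := fun v => ω * (m - 2) / m * v ^ ((m - 2) / (m - 1) - 1)) (fun _ => ?_) (fun _ => ?_)
    (by simp; field_simp; ring) (by simp; field_simp)
  · refine ((((hasDerivAt_id x).const_mul ω).sub
      ((hasDerivAt_pow 2 x).const_mul (ω / m))).sub_const (ω * (m - 1) / m)).congr_deriv ?_
    push_cast
    ring
  · refine (((Real.hasDerivAt_rpow_const (p := (m - 2) / (m - 1))
      (Or.inl hx.ne')).sub_const 1).const_mul ((m - 1) / m * ω)).congr_deriv ?_
    field_simp

lemma B0_deriv_nonpos (hm1 : 1 < m) (hm2 : m < 2) (hω : 0 < ω) {x : ℝ} (hx : m / 2 ≤ x) :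
    deriv (B0 m ω) x ≤ 0 := by
  have hx0 : 0 < x := by linarith
  rw [(B0_hasDerivAt hm1 hx0).deriv]
  split_ifs
  · have : ω - 2 * ω / m * x = 2 * ω / m * (m / 2 - x) := by field_simp
    rw [this]
    exact mul_nonpos_of_nonneg_of_nonpos (by positivity) (by linarith)
  · refine mul_nonpos_of_nonpos_of_nonneg ?_ (by positivity)
    exact div_nonpos_of_nonpos_of_nonneg
      (mul_nonpos_of_nonneg_of_nonpos hω.le (by linarith)) (by linarith)

lemma B0_deriv_ge (hm1 : 1 < m) (hm2 : m < 2) (hω : 0 < ω) {x : ℝ} (hx : 0 < x) :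
    -(ω * (2 - m) / m) ≤ deriv (B0 m ω) x := by
  rw [(B0_hasDerivAt hm1 hx).deriv]
  split_ifs with h
  · have : ω - 2 * ω / m * x = -(ω * (2 - m) / m) + 2 * ω / m * (1 - x) := by field_simp; ring
    rw [this]
    have : 0 ≤ 2 * ω / m * (1 - x) := mul_nonneg (by positivity) (by linarith)
    linarith
  · have hexp : (m - 2) / (m - 1) - 1 ≤ 0 := by
      have : (m - 2) / (m - 1) ≤ 0 :=
        div_nonpos_of_nonpos_of_nonneg (by linarith) (by linarith)
      linarith
    have h1 := Real.rpow_le_one_of_one_le_of_nonpos (not_le.1 h).le hexp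
    have h2 : 0 ≤ ω * (2 - m) / m :=
      div_nonneg (mul_nonneg hω.le (by linarith)) (by linarith)
    have h3 : ω * (m - 2) / m * x ^ ((m - 2) / (m - 1) - 1)
      = -(ω * (2 - m) / m * x ^ ((m - 2) / (m - 1) - 1)) := by ring
    rw [h3]
    exact neg_le_neg (mul_le_of_le_one_right h2 h1)

lemma B0_antitoneOn (hm1 : 1 < m) (hm2 : m < 2) (hω : 0 < ω) :
    AntitoneOn (B0 m ω) (Ici (m / 2)) := by
  have hd : ∀ x ∈ Ici (m / 2), DifferentiableAt ℝ (B0 m ω) x := fun x hx =>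
    (B0_hasDerivAt hm1 (lt_of_lt_of_le (by linarith) hx)).differentiableAt
  exact antitoneOn_of_deriv_nonpos (convex_Ici _)
    (fun x hx => (hd x hx).continuousAt.continuousWithinAt)
    (fun x hx => (hd x (interior_subset hx)).differentiableWithinAt)
    fun x hx => B0_deriv_nonpos hm1 hm2 hω (interior_subset hx)

lemma B0_add_mul_monotoneOn (hm1 : 1 < m) (hm2 : m < 2) (hω : 0 < ω) :
    MonotoneOn (fun x => B0 m ω x + ω * (2 - m) / m * x) (Ioi 0) := by
  have hd : ∀ x ∈ Ioi (0 : ℝ), HasDerivAt (fun x => B0 m ω x + ω * (2 - m) / m * x)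
      (deriv (B0 m ω) x + ω * (2 - m) / m * 1) x := fun x hx =>
    (B0_hasDerivAt hm1 hx).differentiableAt.hasDerivAt.add ((hasDerivAt_id x).const_mul _)
  refine monotoneOn_of_hasDerivWithinAt_nonneg (convex_Ioi _)
    (fun x hx => (hd x hx).continuousAt.continuousWithinAt)
    (fun x hx => (hd x (interior_subset hx)).hasDerivWithinAt) fun x hx => ?_
  have := B0_deriv_ge hm1 hm2 hω (mem_Ioi.1 (interior_subset hx))
  linarith

lemma B0_convexOn (hm1 : 1 < m) (hm2 : m < 2) (hω : 0 < ω) : ConvexOn ℝ (Ici 1) (B0 m ω) := by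
  have hp : (m - 2) / (m - 1) < 0 := div_neg_of_neg_of_pos (by linarith) (by linarith)
  have h : ConvexOn ℝ (Ici 1)
      fun v : ℝ => (m - 1) / m * ω * (v ^ ((m - 2) / (m - 1)) - 1) := by
    have hc : 0 ≤ (m - 1) / m * ω :=
      mul_nonneg (div_nonneg (by linarith) (by linarith)) hω.le
    have h := (convexOn_rpow_of_neg hp).subset (Ici_subset_Ioi.2 one_pos) (convex_Ici 1)
    exact (h.sub (concaveOn_const 1 (convex_Ici 1))).smul hc
  refine h.congr fun x hx => ?_
  rcases (mem_Ici.1 hx).eq_or_lt with rfl | hx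
  · simp only [B0, le_refl, if_true, Real.one_rpow]
    field_simp
  · exact (if_neg hx.not_ge).symm

lemma B0_pos (hm1 : 1 < m) (hω : 0 < ω) {x : ℝ} (hx : m / 2 < x) (hx1 : x < 1) :
    0 < B0 m ω x := by
  have : B0 m ω x = ω / m * ((1 - x) * (x - (m - 1))) := by
    rw [B0, if_pos hx1.le]
    field_simp
    ring
  rw [this]
  exact mul_pos (by positivity) (mul_pos (by linarith) (by linarith))

lemma B0_neg (hm1 : 1 < m) (hm2 : m < 2) (hω : 0 < ω) {x : ℝ} (hx1 : 1 < x) :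
    B0 m ω x < 0 := by
  rw [B0, if_neg hx1.not_ge]
  have hp : (m - 2) / (m - 1) < 0 := div_neg_of_neg_of_pos (by linarith) (by linarith)
  exact mul_neg_of_pos_of_neg (mul_pos (div_pos (by linarith) (by linarith)) hω)
    (sub_neg.2 (Real.rpow_lt_one_of_one_lt_of_neg hx1 hp))

lemma B0_lt_tangent (hm1 : 1 < m) (hω : 0 < ω) {x y : ℝ} (hx : 0 < x) (hxy : x < y)
    (hy : y ≤ 1) : B0 m ω y < B0 m ω x + deriv (B0 m ω) x * (y - x) := by
  rw [(B0_hasDerivAt hm1 hx).deriv, if_pos (hxy.le.trans hy), B0, B0, if_pos hy,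
    if_pos (hxy.le.trans hy)]
  have : 0 < ω / m * (y - x) ^ 2 := mul_pos (by positivity) (pow_pos (sub_pos.2 hxy) 2)
  linear_combination this

/-- Beyond the tangent point `z`, the graph of `B` lies below its chord from `x`. -/
lemma B0_lt_secant (hm1 : 1 < m) (hm2 : m < 2) (hω : 0 < ω) {x z w y : ℝ} (hx : 0 < x)
    (hx1 : x < 1) (hz : 1 < z)
    (hxz : B0 m ω z - B0 m ω x = deriv (B0 m ω) x * (z - x)) (hzw : z < w)
    (hxy : x < y) (hyw : y < w) :
    B0 m ω y < B0 m ω x + (B0 m ω w - B0 m ω x) / (w - x) * (y - x) := by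
  have hconv := B0_convexOn (ω := ω) hm1 hm2 hω
  have h1 := B0_lt_tangent hm1 hω hx hx1 le_rfl
  have hslope : deriv (B0 m ω) x < (B0 m ω w - B0 m ω x) / (w - x) := by
    rw [lt_div_iff₀ (by linarith)]
    have h := hconv.slope_mono_adjacent (x := 1) (y := z) (z := w) self_mem_Ici
      (mem_Ici.2 (by linarith)) hz hzw
    rw [div_le_div_iff₀ (by linarith) (by linarith)] at h
    have : deriv (B0 m ω) x * (w - z) * (z - 1) < (B0 m ω w - B0 m ω z) * (z - 1) := by
      refine lt_of_lt_of_le ?_ h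
      have := mul_lt_mul_of_pos_right
        (show deriv (B0 m ω) x * (z - 1) < B0 m ω z - B0 m ω 1 by linarith) (sub_pos.2 hzw)
      linarith
    have := lt_of_mul_lt_mul_right this (by linarith)
    linarith
  set c := (B0 m ω w - B0 m ω x) / (w - x) with hc
  have hcw : c * (w - x) = B0 m ω w - B0 m ω x := by
    rw [hc]; exact div_mul_cancel₀ _ (by linarith)
  have hbelow : ∀ u, x < u → u ≤ 1 → B0 m ω u < B0 m ω x + c * (u - x) := fun u hu hu1 =>
    (B0_lt_tangent hm1 hω hx hu hu1).trans
      (by linarith [mul_lt_mul_of_pos_right hslope (sub_pos.2 hu)])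
  rcases le_or_gt y 1 with hy1 | hy1
  · exact hbelow y hxy hy1
  · have h := hconv.slope_mono_adjacent (x := 1) (y := y) (z := w) self_mem_Ici
      (mem_Ici.2 (by linarith)) hy1 hyw
    rw [div_le_div_iff₀ (by linarith) (by linarith)] at h
    have h2 := mul_lt_mul_of_pos_right (hbelow 1 hx1 le_rfl) (sub_pos.2 hyw)
    have hw : B0 m ω w = B0 m ω x + c * (w - x) := by linarith
    rw [hw] at h
    refine lt_of_mul_lt_mul_right (a := w - 1) ?_ (by linarith)
    linear_combination h + h2

end Coefficients

/-- Let `ω > 0`, `m ∈ (1,2)`, `α = β = 0`, `m/2 < v⁻ < 1` and `v⁺ > v̄⁺`, where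
`v̄⁺ > 1` is the root of the secant equation
`B(v̄⁺) - B(v⁻) = B′(v⁻)(v̄⁺ - v⁻)`.  With
`c := (B(v⁺) - B(v⁻))/(v⁺ - v⁻) < 0` and `K₀ := B(v⁻) - c v⁻`, there exists a
`C¹`, strictly increasing `v : ℝ → (0,∞)` with `v⁻ < v < v⁺`, limits `v⁻` at
`-∞` and `v⁺` at `+∞`, and `(A(v(ξ)))' = K₀ + c v(ξ) - B(v(ξ))` for all `ξ`.
Consequently `φ(x,t) := v(x + c(T-t))` is a traveling wave solution, with
negative wave speed `c` and increasing profile, of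
`∂ₜφ + ∂ₓₓ A(φ) + ∂ₓ B(φ) = 0`. -/
theorem stmt_19 (m ω T vm vbar vp : ℝ) (hm1 : 1 < m) (hm2 : m < 2) (hω : 0 < ω)
    (h1 : m / 2 < vm) (h2 : vm < 1) (hbar1 : 1 < vbar)
    (hbar2 : B0 m ω vbar - B0 m ω vm = deriv (B0 m ω) vm * (vbar - vm))
    (hvp : vbar < vp) :
    let c : ℝ := (B0 m ω vp - B0 m ω vm) / (vp - vm)
    let K₀ : ℝ := B0 m ω vm - c * vm
    c < 0 ∧
    ∃ v : ℝ → ℝ, ContDiff ℝ 1 v ∧ StrictMono v ∧ (∀ ξ, 0 < v ξ) ∧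
      (∀ ξ, vm < v ξ ∧ v ξ < vp) ∧
      Filter.Tendsto v Filter.atBot (nhds vm) ∧
      Filter.Tendsto v Filter.atTop (nhds vp) ∧
      (∀ ξ, deriv (fun ξ' => A0 m (v ξ')) ξ = K₀ + c * v ξ - B0 m ω (v ξ)) ∧
      (∀ x t : ℝ,
        deriv (fun s => v (x + c * (T - s))) t
          + deriv (deriv (fun y => A0 m (v (y + c * (T - t))))) x
          + deriv (fun y => B0 m ω (v (y + c * (T - t)))) x = 0) := by
  intro c K₀
  have hvm0 : 0 < vm := by linarith
  have hvmp : vm < vp := by linarith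
  have hc : c < 0 := div_neg_of_neg_of_pos
    (by linarith [B0_pos hm1 hω h1 h2, B0_neg hm1 hm2 hω (hbar1.trans hvp)]) (by linarith)
  have hcvp : c * (vp - vm) = B0 m ω vp - B0 m ω vm :=
    div_mul_cancel₀ _ (by linarith)
  refine ⟨hc, ?_⟩
  set q : ℝ := -(1 / (m - 1)) - 1 with hq
  have hq0 : q ≤ 0 := by
    have : 0 < 1 / (m - 1) := one_div_pos.2 (by linarith)
    linarith
  set G : ℝ → ℝ := fun y => K₀ + c * y - B0 m ω y with hG
  set a : ℝ → ℝ := fun y => 1 / m * max y 1 ^ q with ha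
  have ha0 : ∀ y, 0 < a y := fun y => by positivity
  have haq : ∀ y ∈ Ioo vm vp, a vp ≤ a y := fun y hy => by
    refine mul_le_mul_of_nonneg_left ?_ (by positivity)
    exact Real.rpow_le_rpow_of_nonpos (by positivity) (max_le_max_right 1 hy.2.le) hq0
  have hGc : ContinuousOn G (Ioo vm vp) := fun y hy => by
    have := (B0_hasDerivAt (ω := ω) hm1 (hvm0.trans hy.1)).continuousAt
    exact ContinuousAt.continuousWithinAt (by fun_prop)
  have hac : Continuous a := continuous_const.mul
    ((continuous_id.max continuous_const).rpow_const fun y => Or.inl (by positivity))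
  have hGpos : ∀ y ∈ Ioo vm vp, 0 < G y := fun y hy => by
    have : B0 m ω y < B0 m ω vm + c * (y - vm) :=
      B0_lt_secant hm1 hm2 hω hvm0 h2 hbar1 hbar2 hvp hy.1 hy.2
    simp only [hG, K₀]
    linarith
  set N : ℝ := ω * (2 - m) / m with hN
  have hN0 : 0 < N := div_pos (mul_pos hω (by linarith)) (by linarith)
  have hbound : ∀ y ∈ Ioo vm vp, ∀ d, 0 < d → G y ≤ (N - c) * d →
      G y / a y ≤ (N - c) / a vp * d := fun y hy d hd h => by
    rw [div_mul_eq_mul_div]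
    exact div_le_div₀ (mul_nonneg (by linarith) hd.le) h (ha0 vp) (haq y hy)
  obtain ⟨v, hmono, hv, hvd, hbot, htop⟩ := exists_strictMono_profile
    (F := fun y => G y / a y) (L := (N - c) / a vp) hvmp
    (div_pos (by linarith) (ha0 vp)) (hGc.div hac.continuousOn fun y _ => (ha0 y).ne')
    (fun y hy => div_pos (hGpos y hy) (ha0 y))
    (fun y hy => hbound y hy _ (sub_pos.2 hy.1) (by
      have := B0_add_mul_monotoneOn hm1 hm2 hω hvm0 (hvm0.trans hy.1) hy.1.le
      have := mul_neg_of_neg_of_pos hc (sub_pos.2 hy.1)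
      simp only [hG, K₀, hN] at *
      linarith))
    (fun y hy => hbound y hy _ (sub_pos.2 hy.2) (by
      have := B0_antitoneOn hm1 hm2 hω (h1.le.trans hy.1.le) (h1.le.trans hvmp.le) hy.2.le
      have := mul_pos hN0 (sub_pos.2 hy.2)
      simp only [hG, K₀]
      linarith))
  have hv0 : ∀ ξ, 0 < v ξ := fun ξ => hvm0.trans (hv ξ).1
  have hAd : ∀ ξ, HasDerivAt (fun ξ' => A0 m (v ξ')) (G (v ξ)) ξ := fun ξ => by
    have h : HasDerivAt (fun ξ' => A0 m (v ξ')) _ ξ :=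
      (A0_hasDerivAt hm1 (hv0 ξ)).comp ξ (hvd ξ)
    convert h using 1
    exact (mul_div_cancel₀ _ (ha0 (v ξ)).ne').symm
  refine ⟨v, contDiff_one_iff_deriv.2 ⟨fun ξ => (hvd ξ).differentiableAt, ?_⟩, hmono, hv0, hv,
    hbot, htop, fun ξ => (hAd ξ).deriv, fun x t => ?_⟩
  · have hvc : Continuous v := continuous_iff_continuousAt.2 fun ξ => (hvd ξ).continuousAt
    rw [funext fun ξ => (hvd ξ).deriv]
    exact (hGc.div hac.continuousOn fun y _ => (ha0 y).ne').comp_continuous hvc hv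
  · set k := c * (T - t)
    have hB : HasDerivAt (fun y => B0 m ω (v y))
        (deriv (B0 m ω) (v (x + k)) * (G (v (x + k)) / a (v (x + k)))) (x + k) :=
      (B0_hasDerivAt hm1 (hv0 _)).differentiableAt.hasDerivAt.comp (x + k) (hvd _)
    have hAfun : deriv (fun y => A0 m (v (y + k))) = fun y => G (v (y + k)) :=
      funext fun y => ((hAd (y + k)).comp_add_const y k).deriv
    have hGd : HasDerivAt (fun y => G (v (y + k)))
        (c * (G (v (x + k)) / a (v (x + k))) -
          deriv (B0 m ω) (v (x + k)) * (G (v (x + k)) / a (v (x + k)))) x :=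
      HasDerivAt.comp_add_const x k ((((hvd (x + k)).const_mul c).const_add K₀).sub hB)
    have htime : HasDerivAt (fun s => v (x + c * (T - s)))
        (G (v (x + k)) / a (v (x + k)) * (c * -1)) t :=
      (hvd (x + k)).comp t ((((hasDerivAt_id t).const_sub T).const_mul c).const_add x)
    rw [hAfun, htime.deriv, hGd.deriv, (hB.comp_add_const x k).deriv]
    ring
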